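/- Let R be a commutative ring, d, m positive integers, A = (a_{ir}) an m×d matrix with entries in ℕ, p_1,…,p_d ∈ R, N ∈ ℕ, s ∈ ℕ^d with S := Σ_{r=1}^d s_r ≤ N, and k ∈ ℕ^m. Then Σ over j ∈ ℕ^d with j_1+⋯+j_d = N and Aj = k of ( ∏_{r=1}^d j_r^{(s_r)} ) · (N! / (j_1!⋯j_d!)) · ∏_{r=1}^d p_r^{j_r} equals (N!/(N−S)!) · (∏_{r=1}^d p_r^{s_r}) · Σ over j' ∈ ℕ^d with j'_1+⋯+j'_d = N−S and A(j'+s) = k of ((N−S)!/(j'_1!⋯j'_d!)) · ∏_{r=1}^d p_r^{j'_r}, where j_r^{(s_r)} = j_r!/(j_r−s_r)! is the falling factorial (equal to 0 when j_r < s_r). (This is the identity underlying the conditional factorial moments of a multinomial random vector X with parameters N and p_1,…,p_d given Y = AX = k.) -/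

import Mathlib

theorem Nat.prod_descFactorial_mul_multinomial_add {ι : Type*} (t : Finset ι) (f s : ι → ℕ) :
    (∏ i ∈ t, (f i + s i).descFactorial (s i)) * Nat.multinomial t (f + s) =
      (∑ i ∈ t, (f i + s i)).descFactorial (∑ i ∈ t, s i) * Nat.multinomial t f := by
  have hpos : 0 < ∏ i ∈ t, (f i).factorial := Finset.prod_pos fun i _ => (f i).factorial_pos
  have hfac : (∏ i ∈ t, (f i).factorial) * ∏ i ∈ t, (f i + s i).descFactorial (s i) =
      ∏ i ∈ t, ((f + s) i).factorial := by
    rw [← Finset.prod_mul_distrib]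
    refine Finset.prod_congr rfl fun i _ => ?_
    simpa using Nat.factorial_mul_descFactorial (Nat.le_add_left (s i) (f i))
  have hsum : (∑ i ∈ t, f i).factorial * (∑ i ∈ t, (f i + s i)).descFactorial (∑ i ∈ t, s i) =
      (∑ i ∈ t, (f + s) i).factorial := by
    simpa [Finset.sum_add_distrib] using
      Nat.factorial_mul_descFactorial (Nat.le_add_left (∑ i ∈ t, s i) (∑ i ∈ t, f i))
  apply Nat.eq_of_mul_eq_mul_left hpos
  rw [← mul_assoc, hfac, Nat.multinomial_spec, ← hsum, ← Nat.multinomial_spec t f]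
  ring

/-- **Multinomial identity for conditional factorial moments.**  Let `R` be a commutative
ring, `A` an `m × d` matrix of naturals, `p : Fin d → R`, `N ∈ ℕ`, `s ∈ ℕ^d` with
`S = ∑ r, s r ≤ N`, and `k ∈ ℕ^m`.  Then
`∑_{j : ∑ j = N, A j = k} (∏ r, (j r)^(s r)) (N!/(∏ j r !)) ∏ r, p r ^ j r`
equals
`(N!/(N-S)!) (∏ r, p r ^ s r) ∑_{j' : ∑ j' = N - S, A (j'+s) = k} ((N-S)!/(∏ j' r !)) ∏ r, p r ^ j' r`,
where `n^(s)` is the falling factorial. -/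
theorem multinomial_conditional_factorial_moment_identity
    (R : Type*) [CommRing R]
    (d m : ℕ) (hd : 0 < d) (hm : 0 < m)
    (A : Matrix (Fin m) (Fin d) ℕ) (p : Fin d → R) (N : ℕ)
    (s : Fin d → ℕ) (hS : ∑ r : Fin d, s r ≤ N) (k : Fin m → ℕ) :
    ∑ j ∈ (Finset.Nat.antidiagonalTuple d N).filter (fun j => A.mulVec j = k),
        (∏ r : Fin d, ((j r).descFactorial (s r) : R)) *
          (Nat.multinomial Finset.univ j : R) * ∏ r : Fin d, p r ^ j r
      = (N.descFactorial (∑ r : Fin d, s r) : R) * (∏ r : Fin d, p r ^ s r) *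
          ∑ j' ∈ (Finset.Nat.antidiagonalTuple d (N - ∑ r : Fin d, s r)).filter
              (fun j' => A.mulVec (j' + s) = k),
            (Nat.multinomial Finset.univ j' : R) * ∏ r : Fin d, p r ^ j' r := by
  rw [Finset.mul_sum]
  symm
  refine Finset.sum_of_injOn (fun j' => j' + s) (add_left_injective s).injOn ?_ ?_ ?_
  · intro j' hj'
    simp only [Finset.coe_filter, Finset.Nat.mem_antidiagonalTuple, Set.mem_ofPred_eq] at hj' ⊢
    refine ⟨?_, hj'.2⟩
    simp only [Pi.add_apply, Finset.sum_add_distrib]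
    omega
  · intro j hj hnot
    simp only [Finset.mem_filter, Finset.Nat.mem_antidiagonalTuple] at hj
    obtain ⟨r, hr⟩ : ∃ r, j r < s r := by
      by_contra! hle
      have hadd : j - s + s = j := tsub_add_cancel_of_le hle
      refine hnot ⟨j - s, ?_, hadd⟩
      simp only [Finset.coe_filter, Finset.Nat.mem_antidiagonalTuple, Set.mem_ofPred_eq]
      refine ⟨?_, by rw [hadd]; exact hj.2⟩
      simp only [Pi.sub_apply]
      rw [Finset.sum_tsub_distrib _ fun r _ => hle r, hj.1]
    rw [Finset.prod_eq_zero (Finset.mem_univ r) (by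
      rw [Nat.descFactorial_of_lt hr, Nat.cast_zero]), zero_mul, zero_mul]
  · intro j' hj'
    simp only [Finset.mem_filter, Finset.Nat.mem_antidiagonalTuple] at hj'
    have hN : ∑ r, (j' r + s r) = N := by
      rw [Finset.sum_add_distrib]
      omega
    have hcoeff := congrArg (Nat.cast (R := R))
      (Nat.prod_descFactorial_mul_multinomial_add Finset.univ j' s)
    rw [hN] at hcoeff
    push_cast at hcoeff
    simp only [Pi.add_apply]
    rw [hcoeff]
    simp only [pow_add, Finset.prod_mul_distrib]
    ring
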